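/- Let p be a prime and R a commutative ℤ_(p)-algebra in which p is nilpotent. Let W(R) be the ring of p-typical Witt vectors of R with Verschiebung V, and let I_R := V(W(R)) (an ideal of W(R)). Then there exists a divided power structure ε on the ideal pW(R) + I_R of W(R) such that ε_m(p·y) = (p^m/m!)·y^m and ε_m(V(ξ)) = (p^{m−1}/m!)·V(ξ^m) for all y, ξ ∈ W(R) and all m ≥ 1; that is, the canonical divided powers on pW(R) and the divided powers γ_m(V ξ) = (p^{m−1}/m!)·V(ξ^m) on I_R are compatible, extending to a single divided power structure on pW(R) + I_R. -/

import Mathlib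

open WittVector

theorem WittVector.ghostMap_map_injective {σ : Type*} (p : ℕ) [Fact p.Prime] :
    Function.Injective ((ghostMap : WittVector p (MvPolynomial σ ℚ) →+* _).comp
      (WittVector.map (MvPolynomial.map (σ := σ) (Int.castRingHom ℚ)))) := by
  have : Invertible (p : MvPolynomial σ ℚ) := by
    have : Invertible (p : ℚ) := invertibleOfNonzero (by exact_mod_cast (Fact.out : p.Prime).ne_zero)
    exact (Invertible.map (MvPolynomial.C (σ := σ) (R := ℚ)) (p : ℚ)).copy _ (by simp)
  rw [RingHom.coe_comp]
  exact (ghostMap.bijective_of_invertible p _).injective.comp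
    (WittVector.map_injective _ (MvPolynomial.map_injective _ Int.cast_injective))

theorem WittVector.teichmuller_mul {R : Type*} [CommRing R] (p : ℕ) [Fact p.Prime]
    (a : R) (x : WittVector p R) :
    teichmuller p a * x = WittVector.mk p fun n => a ^ p ^ n * x.coeff n := by
  let π : MvPolynomial R ℤ →+* R := (MvPolynomial.aeval (R := ℤ) (id : R → R)).toRingHom
  have hπ : ∀ r, π (MvPolynomial.X r) = r := fun r => by simp [π]
  have key : ∀ (a : MvPolynomial R ℤ) (x : WittVector p (MvPolynomial R ℤ)),
      teichmuller p a * x = WittVector.mk p fun n => a ^ p ^ n * x.coeff n := by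
    intro a x
    apply ghostMap_map_injective p
    funext n
    simp only [RingHom.comp_apply, map_mul, map_teichmuller, Pi.mul_apply, ghostMap_apply,
      ghostComponent_teichmuller]
    simp only [ghostComponent_apply, aeval_wittPolynomial, map_coeff,
      Finset.mul_sum, coeff_mk]
    refine Finset.sum_congr rfl fun i hi => ?_
    rw [map_mul, map_pow, mul_pow, ← pow_mul, ← pow_add,
      Nat.add_sub_cancel' (Nat.lt_succ_iff.mp (Finset.mem_range.mp hi))]
    ring
  have h := congrArg (WittVector.map π)
    (key (MvPolynomial.X a) (WittVector.mk p fun n => MvPolynomial.X (x.coeff n)))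
  rw [map_mul, map_teichmuller, hπ] at h
  have hx : WittVector.map π (WittVector.mk p fun n => MvPolynomial.X (x.coeff n)) = x := by
    ext n
    simp only [map_coeff, coeff_mk, hπ]
  rw [hx] at h
  rw [h]
  ext n
  simp only [map_coeff, coeff_mk, map_mul, map_pow, hπ]

theorem WittVector.exists_verschiebung_eq {R : Type*} [CommRing R] {p : ℕ} [Fact p.Prime]
    {x : WittVector p R} (hx : x.coeff 0 = 0) : ∃ y, verschiebung y = x :=
  ⟨x.shift 1, (verschiebung_shift x 0 (by simpa using hx)).trans (by ext n; simp [shift_coeff])⟩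

theorem WittVector.dvd_coeff_natCast_sub_verschiebung_one (p : ℕ) [Fact p.Prime] (n : ℕ) :
    (p : ℤ) ∣ ((p : WittVector p ℤ) - verschiebung 1).coeff n := by
  have h : WittVector.map (Int.castRingHom (ZMod p)) ((p : WittVector p ℤ) - verschiebung 1) = 0 := by
    rw [map_sub, map_natCast, map_verschiebung, map_one, verschiebung_zmod, one_mul, sub_self]
  have h' := congrArg (fun x => x.coeff n) h
  simp only [map_coeff, zero_coeff, eq_intCast] at h'
  exact (ZMod.intCast_zmod_eq_zero_iff_dvd _ _).mp h'

theorem WittVector.natCast_mul_eq_verschiebung_frobenius {R : Type*} [CommRing R] {p : ℕ}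
    [Fact p.Prime] {y : WittVector p R} (hy : (p : R) * y.coeff 0 = 0) :
    (p : WittVector p R) * y = verschiebung (frobenius y) := by
  set z : WittVector p R := (p : WittVector p R) - verschiebung 1 with hz
  have hz' : z = WittVector.map (Int.castRingHom R) ((p : WittVector p ℤ) - verschiebung 1) := by
    rw [map_sub, map_natCast, map_verschiebung, map_one]
  have hF : frobenius z = 0 := by
    rw [hz, map_sub, map_natCast, frobenius_verschiebung, one_mul, sub_self]
  have hteich : teichmuller p (y.coeff 0) * z = 0 := by
    rw [teichmuller_mul]
    ext n
    obtain ⟨k, hk⟩ := dvd_coeff_natCast_sub_verschiebung_one p n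
    obtain ⟨m, hm⟩ := Nat.exists_eq_succ_of_ne_zero
      (pow_ne_zero n (Fact.out : p.Prime).ne_zero)
    rw [coeff_mk, hz', map_coeff, hk, zero_coeff, hm, pow_succ, map_mul]
    simp only [eq_intCast, Int.cast_natCast]
    linear_combination y.coeff 0 ^ m * (k : R) * hy
  obtain ⟨w, hw⟩ := exists_verschiebung_eq (x := y - teichmuller p (y.coeff 0)) (by
    have := map_sub (constantCoeff (p := p) (R := R)) y (teichmuller p (y.coeff 0))
    simpa [constantCoeff] using this)
  have hyz : y * z = 0 := by
    rw [← sub_add_cancel y (teichmuller p (y.coeff 0)), ← hw, add_mul, hteich,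
      ← verschiebung_mul_frobenius, hF]
    simp
  have h1 : verschiebung (frobenius y) = verschiebung 1 * y := by
    rw [← verschiebung_mul_frobenius, one_mul]
  rw [h1, ← sub_eq_zero, ← sub_mul, ← hz, mul_comm, hyz]

theorem WittVector.verschiebung_pow {R : Type*} [CommRing R] {p : ℕ} [Fact p.Prime]
    (x : WittVector p R) (n : ℕ) :
    verschiebung x ^ (n + 1) = (p : WittVector p R) ^ n * verschiebung (x ^ (n + 1)) := by
  induction n with
  | zero => simp
  | succ n ih =>
    rw [pow_succ, ih, mul_assoc, ← verschiebung_mul_frobenius, frobenius_verschiebung, ← mul_assoc,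
      ← pow_succ, ← nsmul_eq_mul', map_nsmul, nsmul_eq_mul, pow_succ (p : WittVector p R), mul_assoc]

theorem DividedPowers.nonempty_of_injective {B E : Type*} [CommRing B] [CommRing E] [Algebra ℚ E]
    (f : B →+* E) (hf : Function.Injective f) (s : Set B)
    (hs : ∀ x ∈ s, ∀ n ≠ 0, ∃ y ∈ Ideal.span s, (n.factorial : B) * y = x ^ n) :
    Nonempty (DividedPowers (Ideal.span s)) := by
  classical
  have hunit : ∀ n : ℕ, IsUnit (n.factorial : E) := fun n =>
    IsUnit.natCast_factorial_of_algebra ℚ n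
  have htf : ∀ (n : ℕ) (x y : B), (n.factorial : B) * x = n.factorial * y → x = y := by
    intro n x y h
    apply hf
    apply (hunit n).mul_left_cancel
    simpa using congrArg f h
  have key : ∀ x ∈ Ideal.span s, ∀ n : ℕ, ∃ y, (n ≠ 0 → y ∈ Ideal.span s) ∧
      (n.factorial : B) * y = x ^ n := by
    intro x hx
    induction hx using Submodule.span_induction with
    | mem x hx =>
      intro n
      rcases eq_or_ne n 0 with rfl | hn
      · exact ⟨1, by simp, by simp⟩
      · obtain ⟨y, hy, h⟩ := hs x hx n hn
        exact ⟨y, fun _ => hy, h⟩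
    | zero =>
      intro n
      rcases eq_or_ne n 0 with rfl | hn
      · exact ⟨1, by simp, by simp⟩
      · exact ⟨0, by simp, by simp [hn]⟩
    | add x x' _ _ hx hx' =>
      intro n
      choose g hg1 hg2 using hx
      choose g' hg1' hg2' using hx'
      refine ⟨∑ k ∈ Finset.HasAntidiagonal.antidiagonal n, g k.1 * g' k.2, fun hn => ?_, ?_⟩
      · refine Ideal.sum_mem _ fun k hk => ?_
        by_cases h1 : k.1 = 0
        · refine Ideal.mul_mem_left _ _ (hg1' _ fun h2 => hn ?_)
          rw [← Finset.HasAntidiagonal.mem_antidiagonal.mp hk, h1, h2]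
        · exact Ideal.mul_mem_right _ _ (hg1 _ h1)
      · rw [Commute.add_pow' (Commute.all _ _), Finset.mul_sum]
        refine Finset.sum_congr rfl fun k hk => ?_
        rw [← hg2, ← hg2', nsmul_eq_mul, ← Finset.HasAntidiagonal.mem_antidiagonal.mp hk,
          ← Nat.add_choose_mul_factorial_mul_factorial, Nat.choose_symm_add]
        push_cast
        ring
    | smul a x _ hx =>
      intro n
      obtain ⟨y, hy1, hy2⟩ := hx n
      exact ⟨a ^ n * y, fun hn => Ideal.mul_mem_left _ _ (hy1 hn), by
        rw [smul_eq_mul, mul_pow, ← hy2]; ring⟩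
  refine ⟨DividedPowers.ofInjective (Ideal.span s) ((Ideal.span s).map f) f hf
    (DividedPowers.RatAlgebra.dividedPowers _) rfl fun n x hx => ?_⟩
  obtain ⟨y, hy, h⟩ := key x hx n
  refine ⟨y, hy, ?_⟩
  rw [DividedPowers.RatAlgebra.dpow_apply, if_pos (Ideal.mem_map_of_mem f hx), eq_comm,
    Ring.inverse_mul_eq_iff_eq_mul _ _ _ (hunit n), ← map_pow, ← h]
  simp

theorem Localization.AtPrime.exists_factorial_mul_eq_pow (p : ℕ) [hp : Fact p.Prime]
    [hP : (Ideal.span {(p : ℤ)}).IsPrime] {n : ℕ} (hn : n ≠ 0) :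
    ∃ c : Localization.AtPrime (Ideal.span {(p : ℤ)}),
      (n.factorial : Localization.AtPrime (Ideal.span {(p : ℤ)})) * c = p ^ (n - 1) := by
  obtain ⟨u, hu⟩ := pow_padicValNat_dvd (p := p) (n := n.factorial)
  have hpu : ¬ p ∣ u := fun ⟨w, hw⟩ => pow_succ_padicValNat_not_dvd n.factorial_ne_zero
    ⟨w, hu.trans (by rw [hw, pow_succ, mul_assoc])⟩
  have hmem : (u : ℤ) ∈ (Ideal.span {(p : ℤ)}).primeCompl := fun h =>
    hpu (Int.natCast_dvd_natCast.mp (Ideal.mem_span_singleton.mp h))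
  obtain ⟨w, hw⟩ := (IsLocalization.map_units
    (Localization.AtPrime (Ideal.span {(p : ℤ)})) ⟨(u : ℤ), hmem⟩).exists_right_inv
  simp only [eq_intCast, Int.cast_natCast] at hw
  have hlt := padicValNat_factorial_lt_of_ne_zero p hn
  refine ⟨p ^ (n - 1 - padicValNat p n.factorial) * w, ?_⟩
  have hsplit : n - 1 = padicValNat p n.factorial + (n - 1 - padicValNat p n.factorial) := by
    omega
  have hu' := congrArg (Nat.cast (R := Localization.AtPrime (Ideal.span {(p : ℤ)}))) hu
  push_cast at hu'
  conv_rhs => rw [hsplit, pow_add]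
  rw [hu']
  linear_combination (p : Localization.AtPrime (Ideal.span {(p : ℤ)})) ^
    padicValNat p n.factorial * (p : Localization.AtPrime (Ideal.span {(p : ℤ)})) ^
      (n - 1 - padicValNat p n.factorial) * hw

/-- Let `p` be a prime and `R` a commutative `ℤ_(p)`-algebra in which `p`
is nilpotent.  Let `I_R = V(W(R))` be the image of Verschiebung (an ideal of `W(R)`).
Then there is a divided power structure `ε` on the ideal `p·W(R) + I_R` with
`ε_m (p*y) = (p^m/m!) • y^m` and `ε_m (V ξ) = (p^(m-1)/m!) • V (ξ^m)` for all `y, ξ ∈ W(R)`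
and `m ≥ 1`; i.e. the canonical divided powers on `p·W(R)` and the divided powers on `I_R`
are compatible, extending to a single divided power structure on `p·W(R) + I_R`. -/
theorem statement8 (p : ℕ) [hp : Fact p.Prime]
    [hP : (Ideal.span {(p : ℤ)}).IsPrime]
    (R : Type*) [CommRing R]
    [Algebra (Localization.AtPrime (Ideal.span {(p : ℤ)})) R]
    [Algebra (Localization.AtPrime (Ideal.span {(p : ℤ)})) (WittVector p R)]
    (hnil : ∃ n : ℕ, (p : R) ^ n = 0) :
    ∃ I : Ideal (WittVector p R),
      (I : Set (WittVector p R)) = Set.range (⇑(verschiebung : WittVector p R →+ WittVector p R)) ∧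
      ∃ ε : DividedPowers (Ideal.span {(p : WittVector p R)} ⊔ I),
        (∀ (m : ℕ), 1 ≤ m → ∀ (y : WittVector p R)
          (c : Localization.AtPrime (Ideal.span {(p : ℤ)})),
          (Nat.factorial m : Localization.AtPrime (Ideal.span {(p : ℤ)})) * c
              = (p : Localization.AtPrime (Ideal.span {(p : ℤ)})) ^ m →
          ε.dpow m ((p : WittVector p R) * y)
            = algebraMap (Localization.AtPrime (Ideal.span {(p : ℤ)})) (WittVector p R) c
                * y ^ m) ∧
        (∀ (m : ℕ), 1 ≤ m → ∀ (ξ : WittVector p R)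
          (c : Localization.AtPrime (Ideal.span {(p : ℤ)})),
          (Nat.factorial m : Localization.AtPrime (Ideal.span {(p : ℤ)})) * c
              = (p : Localization.AtPrime (Ideal.span {(p : ℤ)})) ^ (m - 1) →
          ε.dpow m (verschiebung ξ)
            = algebraMap (Localization.AtPrime (Ideal.span {(p : ℤ)})) (WittVector p R) c
                * verschiebung (ξ ^ m)) := by
  set Zp := Localization.AtPrime (Ideal.span {(p : ℤ)})
  -- a torsion-free cover of `W(R)` on which the divided powers are `x ^ n / n!`
  let π : MvPolynomial R ℤ →+* R := (MvPolynomial.aeval (R := ℤ) (id : R → R)).toRingHom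
  have hπ : Function.Surjective π := fun r => ⟨MvPolynomial.X r, by simp [π]⟩
  let Wπ : WittVector p (MvPolynomial R ℤ) →+* WittVector p R := WittVector.map π
  have hWπ : Function.Surjective Wπ := WittVector.map_surjective π hπ
  let ι := (ghostMap : WittVector p (MvPolynomial R ℚ) →+* _).comp
      (WittVector.map (MvPolynomial.map (σ := R) (Int.castRingHom ℚ)))
  have hι : Function.Injective ι := ghostMap_map_injective p
  let S : Submonoid (WittVector p (MvPolynomial R ℤ)) :=
    Algebra.algebraMapSubmonoid _ (Ideal.span {(p : ℤ)}).primeCompl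
  let B := Localization S
  let φ : WittVector p (MvPolynomial R ℤ) →+* B := algebraMap _ _
  have hSR : ∀ s : S, IsUnit (Wπ s) := by
    rintro ⟨_, k, hk, rfl⟩
    have := (IsLocalization.map_units (M := (Ideal.span {(p : ℤ)}).primeCompl) Zp ⟨k, hk⟩).map
      (algebraMap Zp (WittVector p R))
    simpa using this
  have hSE : ∀ s : S, IsUnit (ι s) := by
    rintro ⟨_, k, hk, rfl⟩
    have hk0 : (k : ℚ) ≠ 0 := by
      rintro h
      rw [Int.cast_eq_zero] at h
      exact hk (h ▸ zero_mem _)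
    have := (IsUnit.mk0 _ hk0).map (algebraMap ℚ (ℕ → MvPolynomial R ℚ))
    simpa using this
  have hSZ : ∀ k : (Ideal.span {(p : ℤ)}).primeCompl, IsUnit (algebraMap ℤ B k) := by
    intro k
    have := IsLocalization.map_units (M := S) B ⟨_, k, k.2, rfl⟩
    simpa using this
  let g : B →+* WittVector p R := IsLocalization.lift hSR
  let f : B →+* (ℕ → MvPolynomial R ℚ) := IsLocalization.lift hSE
  let χ : Zp →+* B := IsLocalization.lift hSZ
  have hgφ : ∀ x, g (φ x) = Wπ x := fun x => IsLocalization.lift_eq hSR x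
  have hfφ : ∀ x, f (φ x) = ι x := fun x => IsLocalization.lift_eq hSE x
  have hgχ : ∀ c, g (χ c) = algebraMap Zp (WittVector p R) c := by
    intro c
    have : g.comp χ = algebraMap Zp (WittVector p R) :=
      IsLocalization.ringHom_ext (Ideal.span {(p : ℤ)}).primeCompl (RingHom.ext_int _ _)
    rw [← this]; rfl
  have hg : Function.Surjective g := fun x => by
    obtain ⟨y, rfl⟩ := hWπ x
    exact ⟨φ y, hgφ y⟩
  have hf : Function.Injective f := by
    rw [injective_iff_map_eq_zero]
    intro x hx
    obtain ⟨⟨a, s⟩, h⟩ := IsLocalization.surj S x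
    have h2 : ι a = 0 := by
      rw [← hfφ, ← h, map_mul, hx, zero_mul]
    rw [(map_eq_zero_iff ι hι).mp h2, map_zero] at h
    exact (IsLocalization.map_units B s).mul_left_eq_zero.mp h
  have htf : ∀ (n : ℕ) (x y : B), (n.factorial : B) * x = n.factorial * y → x = y := by
    intro n x y h
    apply hf
    apply (IsUnit.natCast_factorial_of_algebra ℚ n).mul_left_cancel
    simpa using congrArg f h
  -- the ideal and its divided powers upstairs
  let s : Set B := insert (p : B) (Set.range fun ξ => φ (verschiebung ξ))
  have hpJ : ∀ y, (p : B) * y ∈ Ideal.span s := fun y =>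
    Ideal.mul_mem_right _ _ (Ideal.subset_span (Set.mem_insert _ _))
  have hVJ : ∀ ξ, φ (verschiebung ξ) ∈ Ideal.span s := fun ξ =>
    Ideal.subset_span (Set.mem_insert_of_mem _ ⟨ξ, rfl⟩)
  have hVpow : ∀ (n : ℕ) (ξ) (c : Zp), n ≠ 0 → (n.factorial : Zp) * c = (p : Zp) ^ (n - 1) →
      (n.factorial : B) * (χ c * φ (verschiebung (ξ ^ n))) = φ (verschiebung ξ) ^ n := by
    intro n ξ c hn hc
    obtain ⟨n, rfl⟩ := Nat.exists_eq_succ_of_ne_zero hn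
    have hc' := congrArg χ hc
    rw [map_mul, map_natCast, map_pow, map_natCast] at hc'
    rw [← mul_assoc, hc', ← map_pow φ, Nat.succ_eq_add_one, verschiebung_pow, map_mul, map_pow φ,
      map_natCast, Nat.add_sub_cancel]
  have hppow : ∀ (n : ℕ) (y : B) (c : Zp), (n.factorial : Zp) * c = (p : Zp) ^ n →
      (n.factorial : B) * (χ c * y ^ n) = ((p : B) * y) ^ n := by
    intro n y c hc
    have hc' := congrArg χ hc
    rw [map_mul, map_natCast, map_pow, map_natCast] at hc'
    rw [← mul_assoc, hc', mul_pow]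
  obtain ⟨δ⟩ : Nonempty (DividedPowers (Ideal.span s)) := by
    refine DividedPowers.nonempty_of_injective f hf s ?_
    rintro x (rfl | ⟨ξ, rfl⟩) n hn <;>
      obtain ⟨c, hc⟩ := Localization.AtPrime.exists_factorial_mul_eq_pow p hn
    · refine ⟨(p : B) * χ c, hpJ _, ?_⟩
      have := hppow n 1 (c * p) (by
        rw [← mul_assoc, hc, ← pow_succ, Nat.sub_add_cancel (Nat.pos_of_ne_zero hn)])
      rw [mul_one] at this
      rw [← this, map_mul, map_natCast]
      ring
    · exact ⟨χ c * φ (verschiebung (ξ ^ n)), Ideal.mul_mem_left _ _ (hVJ _), hVpow n ξ c hn hc⟩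
  have hδp : ∀ (n : ℕ) (y : B) (c : Zp), (n.factorial : Zp) * c = (p : Zp) ^ n →
      δ.dpow n ((p : B) * y) = χ c * y ^ n := fun n y c hc =>
    htf n _ _ ((δ.factorial_mul_dpow_eq_pow (hpJ y)).trans (hppow n y c hc).symm)
  have hδV : ∀ (n : ℕ) (ξ) (c : Zp), n ≠ 0 → (n.factorial : Zp) * c = (p : Zp) ^ (n - 1) →
      δ.dpow n (φ (verschiebung ξ)) = χ c * φ (verschiebung (ξ ^ n)) := fun n ξ c hn hc =>
    htf n _ _ ((δ.factorial_mul_dpow_eq_pow (hVJ ξ)).trans (hVpow n ξ c hn hc).symm)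
  -- the ideal downstairs
  let I : Ideal (WittVector p R) := RingHom.ker (constantCoeff (p := p) (R := R))
  have hI : (I : Set (WittVector p R)) = Set.range (verschiebung (p := p) (R := R)) := by
    ext x
    constructor
    · exact fun hx => exists_verschiebung_eq hx
    · rintro ⟨y, rfl⟩
      exact verschiebung_coeff_zero y
  have hmap : Ideal.span {(p : WittVector p R)} ⊔ I = (Ideal.span s).map g := by
    have hIspan : I = Ideal.span (Set.range (verschiebung (p := p) (R := R))) := by
      rw [← hI, Ideal.span_eq]
    rw [hIspan, ← Ideal.span_union, Ideal.map_span, Set.image_insert_eq, map_natCast,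
      ← Set.range_comp, Set.singleton_union]
    congr 2
    ext x
    constructor
    · rintro ⟨y, rfl⟩
      obtain ⟨y, rfl⟩ := hWπ y
      exact ⟨y, by simp [hgφ, Wπ, map_verschiebung]⟩
    · rintro ⟨y, rfl⟩
      exact ⟨Wπ y, by simp [hgφ, Wπ, map_verschiebung]⟩
  have hJform : ∀ x ∈ Ideal.span s, ∃ (t : S) (y ξ : WittVector p (MvPolynomial R ℤ)),
      φ t * x = (p : B) * φ y + φ (verschiebung ξ) := by
    intro x hx
    induction hx using Submodule.span_induction with
    | mem x hx =>
      rcases hx with rfl | ⟨ξ, rfl⟩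
      · exact ⟨1, 1, 0, by simp⟩
      · exact ⟨1, 0, ξ, by simp⟩
    | zero => exact ⟨1, 0, 0, by simp⟩
    | add x x' _ _ hx hx' =>
      obtain ⟨t, y, ξ, h⟩ := hx
      obtain ⟨t', y', ξ', h'⟩ := hx'
      refine ⟨t * t', t' * y + t * y', ξ * frobenius (t' : WittVector p (MvPolynomial R ℤ)) +
        ξ' * frobenius (t : WittVector p (MvPolynomial R ℤ)), ?_⟩
      simp only [map_add, verschiebung_mul_frobenius, map_mul, Submonoid.coe_mul]
      linear_combination φ t' * h + φ t * h'
    | smul a x _ hx =>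
      obtain ⟨t, y, ξ, h⟩ := hx
      obtain ⟨⟨b, t'⟩, hb⟩ := IsLocalization.surj S a
      refine ⟨t * t', b * y, ξ * frobenius b, ?_⟩
      change a * φ t' = φ b at hb
      simp only [verschiebung_mul_frobenius, map_mul, Submonoid.coe_mul, smul_eq_mul]
      linear_combination φ b * h + φ t * x * hb
  have hker : δ.IsSubDPIdeal (RingHom.ker g ⊓ Ideal.span s) := by
    refine ⟨inf_le_right, fun n hn x hx => ⟨?_, δ.dpow_mem hn hx.2⟩⟩
    obtain ⟨t, y, ξ, h⟩ := hJform x hx.2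
    have hgx : g x = 0 := hx.1
    have ht : IsUnit (g (φ t)) := hgφ t ▸ hSR t
    suffices hz : g (δ.dpow n (φ t * x)) = 0 by
      rw [δ.dpow_mul hx.2, map_mul, map_pow] at hz
      exact (ht.pow n).mul_right_eq_zero.mp hz
    have hrel : (p : WittVector p R) * Wπ y + verschiebung (Wπ ξ) = 0 := by
      have := congrArg g h
      rw [map_mul, hgx, mul_zero, map_add, map_mul, hgφ, hgφ, map_natCast] at this
      rw [← map_verschiebung]
      exact this.symm
    have hy0 : (p : R) * (Wπ y).coeff 0 = 0 := by
      have := congrArg (constantCoeff (p := p) (R := R)) hrel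
      rw [map_add, map_mul, map_natCast, map_zero] at this
      simpa [constantCoeff] using this
    have hξ : Wπ ξ = - frobenius (Wπ y) := by
      apply verschiebung_injective p R
      rw [map_neg, ← natCast_mul_eq_verschiebung_frobenius hy0]
      exact eq_neg_of_add_eq_zero_right hrel
    have hcomp : ∀ j, g (δ.dpow j (φ (verschiebung ξ))) = g (δ.dpow j ((p : B) * φ (-y))) := by
      intro j
      rcases eq_or_ne j 0 with rfl | hj
      · rw [δ.dpow_zero (hVJ ξ), δ.dpow_zero (hpJ _)]
      obtain ⟨c, hc⟩ := Localization.AtPrime.exists_factorial_mul_eq_pow p hj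
      have hyj : (p : R) * ((-Wπ y) ^ j).coeff 0 = 0 := by
        have h0 : ∀ x : WittVector p R, x.coeff 0 = constantCoeff x := fun _ => rfl
        rw [h0] at hy0 ⊢
        obtain ⟨j, rfl⟩ := Nat.exists_eq_succ_of_ne_zero hj
        rw [map_pow, map_neg, pow_succ]
        linear_combination -(-constantCoeff (Wπ y)) ^ j * hy0
      have hVj := natCast_mul_eq_verschiebung_frobenius hyj
      rw [hδV j ξ c hj hc, hδp j _ (c * p) (by
        rw [← mul_assoc, hc, ← pow_succ, Nat.sub_add_cancel (Nat.pos_of_ne_zero hj)])]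
      have hVπ : Wπ (verschiebung (ξ ^ j)) = verschiebung (Wπ ξ ^ j) := by
        rw [← map_pow]
        exact map_verschiebung π _
      rw [map_mul g, map_mul χ, map_mul g, map_mul g, map_natCast, map_natCast, ← map_pow φ, hgφ,
        hgφ, mul_assoc, map_pow Wπ, map_neg Wπ, hVj, map_pow WittVector.frobenius, map_neg WittVector.frobenius, ← hξ, hVπ]
    rw [h, δ.dpow_add (hpJ _) (hVJ _), map_sum]
    simp only [map_mul, hcomp]
    simp only [← map_mul]
    rw [← map_sum, ← δ.dpow_add (hpJ _) (hpJ _), ← mul_add, ← map_add, add_neg_cancel, map_zero,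
      mul_zero, δ.dpow_eval_zero hn, map_zero]
  refine ⟨I, hI, DividedPowers.Quotient.OfSurjective.dividedPowers δ hg hmap hker, ?_, ?_⟩
  · intro m _ y c hc
    obtain ⟨y, rfl⟩ := hg y
    have hpy : (p : WittVector p R) * g y = g ((p : B) * y) := by simp
    rw [hpy, DividedPowers.Quotient.OfSurjective.dpow_apply δ hg hmap hker (hpJ y),
      hδp m y c hc, map_mul, hgχ, map_pow]
  · intro m hm ξ c hc
    obtain ⟨ξ, rfl⟩ := hWπ ξ
    have hV : verschiebung (Wπ ξ) = g (φ (verschiebung ξ)) := by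
      rw [hgφ]; exact (map_verschiebung π ξ).symm
    rw [hV, DividedPowers.Quotient.OfSurjective.dpow_apply δ hg hmap hker (hVJ ξ),
      hδV m ξ c (by omega) hc, map_mul, hgχ, hgφ, ← map_pow]
    exact congrArg _ (map_verschiebung π _)
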